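/- Let k ≥ 0 and m > k be integers, let μ be a probability measure on ℝ with μ([0,k]) = 1, and let f : [0,1] → ℝ be continuous. Then sup_{x∈[0,1]} |L_{m,k}(f;x) − f(x)| ≤ 2k·ω(f; 1/m) + (5/2)·ω₂^σ(f; 1/√m). -/

import Mathlib

open Set Finset MeasureTheory

/-- Bernstein basis polynomial `p_{m,k}(x) = C(m,k) x^k (1-x)^{m-k}`. -/
noncomputable def bern (m k : ℕ) (x : ℝ) : ℝ :=
  (m.choose k : ℝ) * x ^ k * (1 - x) ^ (m - k)

/-- `σ(x) = √(x(1-x))`. -/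
noncomputable def sigm (x : ℝ) : ℝ := Real.sqrt (x * (1 - x))

/-- The first modulus of continuity of `f` on `[0,1]`. -/
noncomputable def omega1 (f : ℝ → ℝ) (δ : ℝ) : ℝ :=
  sSup {v | ∃ x y : ℝ, x ∈ Set.Icc (0:ℝ) 1 ∧ y ∈ Set.Icc (0:ℝ) 1 ∧ |x - y| ≤ δ ∧
    v = |f x - f y|}

/-- The Ditzian–Totik second modulus of smoothness of `f` with weight `σ` on `[0,1]`. -/
noncomputable def omega2DT (f : ℝ → ℝ) (δ : ℝ) : ℝ :=
  sSup {v | ∃ x h : ℝ, 0 ≤ h ∧ h ≤ δ ∧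
    x - h * sigm x ∈ Set.Icc (0:ℝ) 1 ∧ x + h * sigm x ∈ Set.Icc (0:ℝ) 1 ∧
    v = |f (x + h * sigm x) - 2 * f x + f (x - h * sigm x)|}

/-- Bernstein–Kantorovich type operator
`L_{m,k}(f;x) = Σ_{l=0}^{m-k} p_{m-k,l}(x) ∫ f((l+t)/m) dμ(t)`. -/
noncomputable def Lop (m k : ℕ) (μ : Measure ℝ) (f : ℝ → ℝ) (x : ℝ) : ℝ :=
  ∑ l ∈ Finset.range (m - k + 1), bern (m - k) l x * ∫ t, f (((l : ℝ) + t) / m) ∂μ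

lemma two_mul_le_log_one_add_sub_log_one_sub {r : ℝ} (h0 : 0 ≤ r) (h1 : r < 1) :
    2 * r ≤ Real.log (1 + r) - Real.log (1 - r) := by
  have hs := Real.hasSum_log_sub_log_of_abs_lt_one (x := r) (by rwa [abs_of_nonneg h0])
  have h := hs.summable.sum_le_tsum (Finset.range 1) (fun i _ => by positivity)
  rw [hs.tsum_eq] at h
  simpa using h

lemma sq_le_neg_negMulLog_add {r : ℝ} (h0 : 0 ≤ r) (h1 : r ≤ 1) :
    r ^ 2 ≤ -Real.negMulLog (1 + r) - Real.negMulLog (1 - r) := by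
  let F : ℝ → ℝ := fun r => -Real.negMulLog (1 + r) - Real.negMulLog (1 - r) - r ^ 2
  have hmono : MonotoneOn F (Set.Icc 0 1) := by
    refine monotoneOn_of_hasDerivWithinAt_nonneg (convex_Icc 0 1)
      (f' := fun r => Real.log (1 + r) - Real.log (1 - r) - 2 * r) ?_ ?_ ?_
    · exact Continuous.continuousOn (by fun_prop)
    · intro r hr
      rw [interior_Icc] at hr
      have e1 : HasDerivAt (fun r : ℝ => 1 + r) 1 r := (hasDerivAt_id r).const_add 1
      have e2 : HasDerivAt (fun r : ℝ => 1 - r) (-1) r := (hasDerivAt_id r).const_sub 1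
      have d1 := (Real.hasDerivAt_negMulLog (x := 1 + r) (by linarith [hr.1])).comp r e1
      have d2 := (Real.hasDerivAt_negMulLog (x := 1 - r) (by linarith [hr.2])).comp r e2
      have d3 := (d1.neg.sub d2).sub (hasDerivAt_pow 2 r)
      refine HasDerivAt.hasDerivWithinAt (d3.congr_deriv ?_)
      norm_num
    · intro r hr
      rw [interior_Icc] at hr
      have := two_mul_le_log_one_add_sub_log_one_sub hr.1.le hr.2
      linarith
  have h := hmono (Set.left_mem_Icc.2 zero_le_one) ⟨h0, h1⟩ h0
  simp only [F] at h
  norm_num at h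
  linarith

lemma negMulLog_second_difference_le {u d : ℝ} (hu : 0 < u) (hd : 0 ≤ d) (hdu : d ≤ u) :
    Real.negMulLog (u + d) - 2 * Real.negMulLog u + Real.negMulLog (u - d) ≤ -(d ^ 2 / u) := by
  have key := sq_le_neg_negMulLog_add (div_nonneg hd hu.le) ((div_le_one hu).2 hdu)
  have e1 : u + d = u * (1 + d / u) := by field_simp
  have e2 : u - d = u * (1 - d / u) := by field_simp
  rw [e1, e2, Real.negMulLog_mul, Real.negMulLog_mul]
  have e3 : d ^ 2 / u = u * (d / u) ^ 2 := by field_simp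
  rw [e3]
  nlinarith [mul_le_mul_of_nonneg_left key hu.le]

lemma binEntropy_second_difference_le {u d : ℝ} (hd : 0 < d) (h0 : 0 ≤ u - d) (h1 : u + d ≤ 1) :
    Real.binEntropy (u + d) - 2 * Real.binEntropy u + Real.binEntropy (u - d) ≤
      -(d ^ 2 / (u * (1 - u))) := by
  have hu : 0 < u := by linarith
  have hu1 : 0 < 1 - u := by linarith
  have a := negMulLog_second_difference_le hu hd.le (by linarith)
  have b := negMulLog_second_difference_le hu1 hd.le (by linarith)
  simp only [Real.binEntropy_eq_negMulLog_add_negMulLog_one_sub]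
  have e1 : 1 - (u + d) = 1 - u - d := by ring
  have e2 : 1 - (u - d) = 1 - u + d := by ring
  have e3 : d ^ 2 / (u * (1 - u)) = d ^ 2 / u + d ^ 2 / (1 - u) := by
    field_simp
    ring
  rw [e1, e2, e3]
  linarith

lemma sub_sq_div_le_negMulLog {t x : ℝ} (ht : 0 ≤ t) (hx : 0 < x) :
    t - t ^ 2 / x - t * Real.log x ≤ Real.negMulLog t := by
  rcases ht.eq_or_lt with rfl | ht
  · simp
  have h := Real.log_le_sub_one_of_pos (div_pos ht hx)
  rw [Real.log_div ht.ne' hx.ne'] at h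
  have h2 := mul_le_mul_of_nonneg_left h ht.le
  have e : t ^ 2 / x = t * (t / x) := by ring
  rw [Real.negMulLog, e]
  linarith

lemma binEntropy_ge {t x : ℝ} (ht : t ∈ Set.Icc (0 : ℝ) 1) (hx : x ∈ Set.Ioo (0 : ℝ) 1) :
    Real.binEntropy x + (Real.log (1 - x) - Real.log x) * (t - x) - (t - x) ^ 2 / (x * (1 - x)) ≤
      Real.binEntropy t := by
  have hx0 := hx.1
  have hx1 : 0 < 1 - x := by linarith [hx.2]
  have a := sub_sq_div_le_negMulLog ht.1 hx0
  have b := sub_sq_div_le_negMulLog (sub_nonneg.2 ht.2) hx1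
  have e : (t - x) ^ 2 / (x * (1 - x)) = t ^ 2 / x + (1 - t) ^ 2 / (1 - x) - 1 := by
    field_simp
    ring
  rw [Real.binEntropy_eq_negMulLog_add_negMulLog_one_sub,
    Real.binEntropy_eq_negMulLog_add_negMulLog_one_sub, e, Real.negMulLog.eq_1 x,
    Real.negMulLog.eq_1 (1 - x)]
  linarith

/-- A continuous function whose second differences with step `d` at `u` are at least `-W` when
`a d² ≤ u (1 - u)`, and nonnegative in case of equality, is convex up to the error `W`. -/
lemma le_chord_add_of_second_difference {G : ℝ → ℝ} (hG : ContinuousOn G (Set.Icc 0 1))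
    {a W : ℝ} (ha : 0 < a) (hW : 0 ≤ W)
    (h1 : ∀ u d : ℝ, 0 < d → 0 ≤ u - d → u + d ≤ 1 → a * d ^ 2 ≤ u * (1 - u) →
      -W ≤ G (u + d) - 2 * G u + G (u - d))
    (h2 : ∀ u d : ℝ, 0 < d → 0 ≤ u - d → u + d ≤ 1 → a * d ^ 2 = u * (1 - u) →
      0 ≤ G (u + d) - 2 * G u + G (u - d))
    {y z x : ℝ} (hy : 0 ≤ y) (hz : z ≤ 1) (hyx : y < x) (hxz : x < z) :
    G x ≤ G y + (G z - G y) / (z - y) * (x - y) + W := by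
  by_contra! hcon
  set B := (G z - G y) / (z - y) with hB
  let ψ : ℝ → ℝ := fun t => G t - G y - B * (t - y)
  have hψy : ψ y = 0 := by simp [ψ]
  have hψz : ψ z = 0 := by
    have : z - y ≠ 0 := by linarith
    simp only [ψ, hB]
    field_simp
    ring
  have hψx : W < ψ x := by simp only [ψ]; linarith
  have hcont : ContinuousOn ψ (Set.Icc y z) := by
    have : ContinuousOn G (Set.Icc y z) := hG.mono (Set.Icc_subset_Icc hy hz)
    fun_prop
  obtain ⟨c₀, hc₀, hmax⟩ := isCompact_Icc.exists_isMaxOn ⟨x, hyx.le, hxz.le⟩ hcont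
  have hclosed : IsClosed (Set.Icc y z ∩ ψ ⁻¹' {ψ c₀}) :=
    hcont.preimage_isClosed_of_isClosed isClosed_Icc isClosed_singleton
  obtain ⟨c, ⟨hcI, hcM⟩, hleast⟩ :=
    (isCompact_Icc.of_isClosed_subset hclosed Set.inter_subset_left).exists_isLeast
      ⟨c₀, hc₀, rfl⟩
  have hcM : ψ c = ψ c₀ := hcM
  have hle : ∀ t ∈ Set.Icc y z, ψ t ≤ ψ c := fun t ht => hcM ▸ hmax ht
  have hWc : W < ψ c := hψx.trans_le (hle x ⟨hyx.le, hxz.le⟩)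
  have hyc : y < c := lt_of_le_of_ne hcI.1 (by rintro rfl; linarith)
  have hcz : c < z := lt_of_le_of_ne hcI.2 (by rintro rfl; linarith)
  have hlt : ∀ d, 0 < d → y ≤ c - d → ψ (c - d) < ψ c := fun d hd hyd =>
    lt_of_le_of_ne (hle _ ⟨hyd, by linarith⟩) fun h => by
      have := hleast ⟨⟨hyd, by linarith⟩, h.trans hcM⟩
      linarith
  have hdiff : ∀ d, G (c + d) - 2 * G c + G (c - d) = ψ (c + d) - 2 * ψ c + ψ (c - d) := by
    intro d
    simp only [ψ]
    ring
  have hc : 0 < c * (1 - c) := mul_pos (by linarith) (by linarith)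
  set D := Real.sqrt (c * (1 - c) / a) with hD
  have hDpos : 0 < D := Real.sqrt_pos.2 (by positivity)
  have hDsq : a * D ^ 2 = c * (1 - c) := by
    rw [hD, Real.sq_sqrt (by positivity)]
    field_simp
  have hstep : ∀ d, 0 < d → d ≤ D → y ≤ c - d → c + d ≤ z →
      -W ≤ ψ (c + d) - 2 * ψ c + ψ (c - d) := fun d hd hdD hl hr => by
    rw [← hdiff]
    refine h1 c d hd (by linarith) (by linarith) ?_
    rw [← hDsq]
    gcongr
  rcases le_or_gt (c - y) D with hl | hl
  · rcases le_total (c - y) (z - c) with hs | hs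
    · have h := hstep (c - y) (by linarith) hl (by linarith) (by linarith)
      have h' := hle (c + (c - y)) ⟨by linarith, by linarith⟩
      rw [sub_sub_cancel, hψy] at h
      linarith
    · have h := hstep (z - c) (by linarith) (by linarith) (by linarith) (by linarith)
      have h' := hle (c - (z - c)) ⟨by linarith, by linarith⟩
      rw [add_sub_cancel, hψz] at h
      linarith
  · rcases le_or_gt (z - c) D with hr | hr
    · have h := hstep (z - c) (by linarith) (by linarith) (by linarith) (by linarith)
      have h' := hle (c - (z - c)) ⟨by linarith, by linarith⟩
      rw [add_sub_cancel, hψz] at h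
      linarith
    · have h := h2 c D hDpos (by linarith) (by linarith) hDsq
      rw [hdiff] at h
      have h' := hle (c + D) ⟨by linarith, by linarith⟩
      have h'' := hlt D hDpos (by linarith)
      linarith

/-- A function that is convex up to the error `W` has an affine minorant touching it up to `W`. -/
lemma exists_affine_minorant_of_le_chord_add {G : ℝ → ℝ} {W x : ℝ} (hW : 0 ≤ W)
    (hx : x ∈ Set.Ioo (0 : ℝ) 1)
    (h : ∀ y z : ℝ, 0 ≤ y → z ≤ 1 → y < x → x < z →
      G x ≤ G y + (G z - G y) / (z - y) * (x - y) + W) :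
    ∃ s : ℝ, ∀ t ∈ Set.Icc (0 : ℝ) 1, G x - W + s * (t - x) ≤ G t := by
  obtain ⟨s, hs1, hs2⟩ := exists_between_of_forall_le
    (s := (fun y => (G x - W - G y) / (x - y)) '' Set.Ico 0 x)
    (t := (fun z => (G z - (G x - W)) / (z - x)) '' Set.Ioc x 1)
    ⟨_, 0, ⟨le_rfl, hx.1⟩, rfl⟩ ⟨_, 1, ⟨hx.2, le_rfl⟩, rfl⟩ (by
      rintro _ ⟨y, hy, rfl⟩ _ ⟨z, hz, rfl⟩
      have hyx := sub_pos.2 hy.2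
      have hxz := sub_pos.2 hz.1
      have hyz : 0 < z - y := by linarith
      have key := h y z hy.1 hz.2 hy.2 hz.1
      have key' : (G x - W - G y) * (z - y) ≤ (G z - G y) * (x - y) := by
        have e : (G z - G y) * (x - y) = (G z - G y) / (z - y) * (x - y) * (z - y) := by
          field_simp
        rw [e]
        exact mul_le_mul_of_nonneg_right (by linarith) hyz.le
      change (G x - W - G y) / (x - y) ≤ (G z - (G x - W)) / (z - x)
      rw [div_le_div_iff₀ hyx hxz]
      linarith)
  refine ⟨s, fun t ht => ?_⟩
  rcases lt_trichotomy t x with hlt | rfl | hgt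
  · have := hs1 ⟨t, ⟨ht.1, hlt⟩, rfl⟩
    rw [div_le_iff₀ (sub_pos.2 hlt)] at this
    linarith
  · simpa using hW
  · have := hs2 ⟨t, ⟨hgt, ht.2⟩, rfl⟩
    rw [le_div_iff₀ (sub_pos.2 hgt)] at this
    linarith

lemma exists_quadratic_minorant {f : ℝ → ℝ} (hf : ContinuousOn f (Set.Icc 0 1))
    {a W x : ℝ} (ha : 0 < a) (hW : 0 ≤ W) (hx : x ∈ Set.Ioo (0 : ℝ) 1)
    (h : ∀ u d : ℝ, 0 < d → 0 ≤ u - d → u + d ≤ 1 → a * d ^ 2 ≤ u * (1 - u) →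
      -W ≤ f (u + d) - 2 * f u + f (u - d)) :
    ∃ s : ℝ, ∀ t ∈ Set.Icc (0 : ℝ) 1,
      f x - W + s * (t - x) - a * W / (x * (1 - x)) * (t - x) ^ 2 ≤ f t := by
  have haW : 0 ≤ a * W := by positivity
  let G : ℝ → ℝ := fun t => f t - a * W * Real.binEntropy t
  have hG : ContinuousOn G (Set.Icc 0 1) :=
    hf.sub (continuous_const.mul Real.binEntropy_continuous).continuousOn
  have hdiff : ∀ u d : ℝ, 0 < d → 0 ≤ u - d → u + d ≤ 1 → a * d ^ 2 ≤ u * (1 - u) →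
      -W + W * (a * d ^ 2 / (u * (1 - u))) ≤ G (u + d) - 2 * G u + G (u - d) := by
    intro u d hd h0 h1 had
    have e := mul_le_mul_of_nonneg_left (binEntropy_second_difference_le hd h0 h1) haW
    have e' : W * (a * d ^ 2 / (u * (1 - u))) = a * W * (d ^ 2 / (u * (1 - u))) := by ring
    have := h u d hd h0 h1 had
    simp only [G]
    linarith
  obtain ⟨s, hs⟩ := exists_affine_minorant_of_le_chord_add (G := G) hW hx
    fun y z hy hz hyx hxz => le_chord_add_of_second_difference hG ha hW
      (fun u d hd h0 h1 had => by
        have : 0 < u * (1 - u) := mul_pos (by linarith) (by linarith)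
        have : 0 ≤ W * (a * d ^ 2 / (u * (1 - u))) := by positivity
        linarith [hdiff u d hd h0 h1 had])
      (fun u d hd h0 h1 had => by
        have : 0 < u * (1 - u) := mul_pos (by linarith) (by linarith)
        have e := hdiff u d hd h0 h1 had.le
        rw [had, div_self this.ne'] at e
        linarith)
      hy hz hyx hxz
  refine ⟨s + a * W * (Real.log (1 - x) - Real.log x), fun t ht => ?_⟩
  have e := mul_le_mul_of_nonneg_left (binEntropy_ge ht hx) haW
  have e' : a * W / (x * (1 - x)) * (t - x) ^ 2 = a * W * ((t - x) ^ 2 / (x * (1 - x))) := by ring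
  have := hs t ht
  simp only [G] at this
  rw [e']
  linarith

lemma bern_eq_eval (n l : ℕ) (x : ℝ) : bern n l x = (bernsteinPolynomial ℝ n l).eval x := by
  simp [bern, bernsteinPolynomial]

lemma bern_nonneg (n l : ℕ) {x : ℝ} (hx : x ∈ Set.Icc (0 : ℝ) 1) : 0 ≤ bern n l x :=
  mul_nonneg (mul_nonneg (Nat.cast_nonneg _) (pow_nonneg hx.1 _))
    (pow_nonneg (sub_nonneg.2 hx.2) _)

lemma sum_bern (n : ℕ) (x : ℝ) : ∑ l ∈ Finset.range (n + 1), bern n l x = 1 := by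
  simp only [bern_eq_eval, ← Polynomial.eval_finsetSum, bernsteinPolynomial.sum,
    Polynomial.eval_one]

lemma sum_bern_mul_natCast (n : ℕ) (x : ℝ) :
    ∑ l ∈ Finset.range (n + 1), bern n l x * l = n * x := by
  have h := congrArg (Polynomial.eval x) (bernsteinPolynomial.sum_smul ℝ n)
  simp only [Polynomial.eval_finsetSum, nsmul_eq_mul, Polynomial.eval_mul,
    Polynomial.eval_natCast, Polynomial.eval_X, ← bern_eq_eval] at h
  simpa only [mul_comm] using h

lemma sum_bern_mul_sq (n : ℕ) (x : ℝ) :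
    ∑ l ∈ Finset.range (n + 1), bern n l x * (n * x - l) ^ 2 = n * x * (1 - x) := by
  have h := congrArg (Polynomial.eval x) (bernsteinPolynomial.variance ℝ n)
  simp only [Polynomial.eval_finsetSum, nsmul_eq_mul, Polynomial.eval_mul, Polynomial.eval_pow,
    Polynomial.eval_sub, Polynomial.eval_one,
    Polynomial.eval_natCast, Polynomial.eval_X, ← bern_eq_eval] at h
  simpa only [mul_comm, mul_assoc] using h

lemma sum_bern_succ (n : ℕ) (x : ℝ) (g : ℕ → ℝ) :
    ∑ l ∈ Finset.range (n + 2), bern (n + 1) l x * g l =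
      ∑ l ∈ Finset.range (n + 1), bern n l x * ((1 - x) * g l + x * g (l + 1)) := by
  have hrec : ∀ l ∈ Finset.range (n + 1), bern (n + 1) (l + 1) x =
      x * bern n l x + (1 - x) * bern n (l + 1) x := by
    intro l hl
    rcases (Nat.lt_succ_iff.1 (Finset.mem_range.1 hl)).eq_or_lt with rfl | hl
    · simp [bern, pow_succ, mul_comm]
    · obtain ⟨j, rfl⟩ := Nat.exists_eq_add_of_lt hl
      have e1 : l + j + 1 + 1 - (l + 1) = j + 1 := by lia
      have e2 : l + j + 1 - l = j + 1 := by lia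
      have e3 : l + j + 1 - (l + 1) = j := by lia
      simp only [bern, e1, e2, e3, Nat.choose_succ_succ (l + j + 1) l]
      push_cast
      ring
  have hlast : bern n (n + 1) x = 0 := by simp [bern]
  have h0 : bern (n + 1) 0 x = (1 - x) * bern n 0 x := by
    simp [bern, pow_succ, mul_comm]
  have hshift : ∑ l ∈ Finset.range (n + 1), bern n l x * g l =
      (∑ l ∈ Finset.range (n + 1), bern n (l + 1) x * g (l + 1)) + bern n 0 x * g 0 := by
    rw [← Finset.sum_range_succ' (fun l => bern n l x * g l), Finset.sum_range_succ _ (n + 1), hlast]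
    ring
  rw [Finset.sum_range_succ', h0, Finset.sum_congr rfl fun l hl => by rw [hrec l hl]]
  have e : ∑ l ∈ Finset.range (n + 1), bern n l x * ((1 - x) * g l + x * g (l + 1)) =
      (1 - x) * (∑ l ∈ Finset.range (n + 1), bern n l x * g l) +
        x * ∑ l ∈ Finset.range (n + 1), bern n l x * g (l + 1) := by
    rw [Finset.mul_sum, Finset.mul_sum, ← Finset.sum_add_distrib]
    exact Finset.sum_congr rfl fun l _ => by ring
  rw [e, hshift]
  simp only [add_mul, Finset.sum_add_distrib, mul_add, Finset.mul_sum, mul_assoc]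
  ring

/-- Degree elevation by `k` moves the coefficients of a Bernstein sum by at most the oscillation
over windows of length `k`. -/
lemma abs_sum_bern_sub_sum_bern_le {x : ℝ} (hx : x ∈ Set.Icc (0 : ℝ) 1) (n k : ℕ) (A g : ℕ → ℝ)
    {C : ℝ} (h : ∀ l ≤ n, ∀ i ≤ k, |A l - g (l + i)| ≤ C) :
    |∑ l ∈ Finset.range (n + 1), bern n l x * A l -
      ∑ j ∈ Finset.range (n + k + 1), bern (n + k) j x * g j| ≤ C := by
  induction k generalizing g with
  | zero =>
    rw [add_zero, ← Finset.sum_sub_distrib]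
    calc _ ≤ ∑ l ∈ Finset.range (n + 1), |bern n l x * A l - bern n l x * g l| :=
          Finset.abs_sum_le_sum_abs _ _
      _ ≤ ∑ l ∈ Finset.range (n + 1), bern n l x * C := by
          refine Finset.sum_le_sum fun l hl => ?_
          rw [← mul_sub, abs_mul, abs_of_nonneg (bern_nonneg n l hx)]
          exact mul_le_mul_of_nonneg_left
            (h l (Nat.lt_succ_iff.1 (Finset.mem_range.1 hl)) 0 le_rfl) (bern_nonneg n l hx)
      _ = C := by rw [← Finset.sum_mul, sum_bern, one_mul]
  | succ k ih =>
    rw [← add_assoc, sum_bern_succ]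
    refine ih _ fun l hl i hi => ?_
    have h1 := abs_le.1 (h l hl i (by lia))
    have h2 := abs_le.1 (h l hl (i + 1) (by lia))
    rw [← add_assoc] at h2
    have hx0 := hx.1
    have hx1 := sub_nonneg.2 hx.2
    rw [abs_le]
    constructor
    · linarith [mul_le_mul_of_nonneg_left h1.1 hx1, mul_le_mul_of_nonneg_left h2.1 hx0]
    · linarith [mul_le_mul_of_nonneg_left h1.2 hx1, mul_le_mul_of_nonneg_left h2.2 hx0]

lemma sum_bern_zero (n : ℕ) (g : ℕ → ℝ) :
    ∑ l ∈ Finset.range (n + 1), bern n l 0 * g l = g 0 := by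
  rw [Finset.sum_eq_single 0] <;> simp +contextual [bern]

lemma sum_bern_one (n : ℕ) (g : ℕ → ℝ) :
    ∑ l ∈ Finset.range (n + 1), bern n l 1 * g l = g n := by
  rw [Finset.sum_eq_single n]
  · simp [bern]
  · intro l hl hln
    have : n - l ≠ 0 := by have := Finset.mem_range.1 hl; lia
    simp [bern, this]
  · simp

lemma natCast_div_mem_Icc {l m : ℕ} (h : l ≤ m) : (l : ℝ) / m ∈ Set.Icc (0 : ℝ) 1 :=
  ⟨by positivity, div_le_one_of_le₀ (by exact_mod_cast h) (Nat.cast_nonneg m)⟩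

lemma sub_two_mul_le_sum_bern {f : ℝ → ℝ} (hf : ContinuousOn f (Set.Icc 0 1)) {m : ℕ} (hm : 0 < m)
    {W x : ℝ} (hW : 0 ≤ W) (hx : x ∈ Set.Icc (0 : ℝ) 1)
    (h : ∀ u d : ℝ, 0 < d → 0 ≤ u - d → u + d ≤ 1 → m * d ^ 2 ≤ u * (1 - u) →
      -W ≤ f (u + d) - 2 * f u + f (u - d)) :
    f x - 2 * W ≤ ∑ l ∈ Finset.range (m + 1), bern m l x * f (l / m) := by
  have hm' : (0 : ℝ) < m := Nat.cast_pos.2 hm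
  rcases hx.1.eq_or_lt with rfl | hx0
  · rw [sum_bern_zero m fun l => f (l / m)]
    simpa using hW
  rcases hx.2.eq_or_lt with rfl | hx1
  · rw [sum_bern_one m fun l => f (l / m), div_self hm'.ne']
    linarith
  obtain ⟨s, hs⟩ := exists_quadratic_minorant hf hm' hW ⟨hx0, hx1⟩ h
  have hx1' : 1 - x ≠ 0 := by linarith
  calc f x - 2 * W = (f x - W - s * x) * (∑ l ∈ Finset.range (m + 1), bern m l x) +
        s / m * (∑ l ∈ Finset.range (m + 1), bern m l x * l) -
        W / (m * (x * (1 - x))) *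
          ∑ l ∈ Finset.range (m + 1), bern m l x * (m * x - l) ^ 2 := by
        rw [sum_bern, sum_bern_mul_natCast, sum_bern_mul_sq]
        field_simp
        ring
    _ = ∑ l ∈ Finset.range (m + 1), bern m l x *
        (f x - W + s * ((l : ℝ) / m - x) - m * W / (x * (1 - x)) * ((l : ℝ) / m - x) ^ 2) := by
        rw [Finset.mul_sum, Finset.mul_sum, Finset.mul_sum, ← Finset.sum_add_distrib,
          ← Finset.sum_sub_distrib]
        refine Finset.sum_congr rfl fun l _ => ?_
        field_simp
        ring
    _ ≤ _ := Finset.sum_le_sum fun l hl => mul_le_mul_of_nonneg_left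
        (hs _ (natCast_div_mem_Icc (Nat.lt_succ_iff.1 (Finset.mem_range.1 hl))))
        (bern_nonneg m l hx)

lemma exists_abs_le_of_continuousOn_Icc {f : ℝ → ℝ} (hf : ContinuousOn f (Set.Icc 0 1)) :
    ∃ C, ∀ x ∈ Set.Icc (0 : ℝ) 1, |f x| ≤ C :=
  isCompact_Icc.exists_bound_of_continuousOn hf

lemma abs_sub_le_omega1 {f : ℝ → ℝ} (hf : ContinuousOn f (Set.Icc 0 1)) {δ x y : ℝ}
    (hx : x ∈ Set.Icc (0 : ℝ) 1) (hy : y ∈ Set.Icc (0 : ℝ) 1) (hxy : |x - y| ≤ δ) :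
    |f x - f y| ≤ omega1 f δ := by
  obtain ⟨C, hC⟩ := exists_abs_le_of_continuousOn_Icc hf
  refine le_csSup ⟨C + C, ?_⟩ ⟨x, y, hx, hy, hxy, rfl⟩
  rintro _ ⟨x, y, hx, hy, -, rfl⟩
  exact (abs_sub _ _).trans (add_le_add (hC x hx) (hC y hy))

lemma omega1_nonneg (f : ℝ → ℝ) (δ : ℝ) : 0 ≤ omega1 f δ :=
  Real.sSup_nonneg (by rintro _ ⟨x, y, -, -, -, rfl⟩; exact abs_nonneg _)

lemma omega2DT_nonneg (f : ℝ → ℝ) (δ : ℝ) : 0 ≤ omega2DT f δ :=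
  Real.sSup_nonneg (by rintro _ ⟨x, h, -, -, -, -, rfl⟩; exact abs_nonneg _)

lemma abs_second_difference_le_omega2DT {f : ℝ → ℝ} (hf : ContinuousOn f (Set.Icc 0 1)) {m : ℕ}
    (hm : 0 < m) {u d : ℝ} (hd : 0 < d) (h0 : 0 ≤ u - d) (h1 : u + d ≤ 1)
    (hmd : m * d ^ 2 ≤ u * (1 - u)) :
    |f (u + d) - 2 * f u + f (u - d)| ≤ omega2DT f (1 / Real.sqrt m) := by
  obtain ⟨C, hC⟩ := exists_abs_le_of_continuousOn_Icc hf
  have hm' : (0 : ℝ) < m := Nat.cast_pos.2 hm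
  have hσ : 0 < sigm u := Real.sqrt_pos.2 (mul_pos (by linarith) (by linarith))
  have hdσ : d / sigm u * sigm u = d := div_mul_cancel₀ _ hσ.ne'
  refine le_csSup ⟨C + 2 * C + C, ?_⟩ ⟨u, d / sigm u, by positivity, ?_, ?_, ?_, ?_⟩
  · rintro _ ⟨x, h, hh, -, hl, hr, rfl⟩
    have hs : 0 ≤ h * sigm x := mul_nonneg hh (Real.sqrt_nonneg _)
    have h1 := abs_le.1 (hC _ hl)
    have h2 := abs_le.1 (hC _ hr)
    have h3 := abs_le.1 (hC x ⟨by linarith [hl.1], by linarith [hr.2]⟩)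
    rw [abs_le]
    constructor <;> linarith
  · rw [div_le_div_iff₀ hσ (Real.sqrt_pos.2 hm'), one_mul, sigm]
    refine Real.le_sqrt_of_sq_le ?_
    rw [mul_pow, Real.sq_sqrt hm'.le]
    linarith
  · rw [hdσ]
    exact ⟨h0, by linarith⟩
  · rw [hdσ]
    exact ⟨by linarith, h1⟩
  · rw [hdσ]

lemma abs_sum_bern_sub_le {f : ℝ → ℝ} (hf : ContinuousOn f (Set.Icc 0 1)) {m : ℕ} (hm : 0 < m)
    {x : ℝ} (hx : x ∈ Set.Icc (0 : ℝ) 1) :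
    |∑ l ∈ Finset.range (m + 1), bern m l x * f (l / m) - f x| ≤
      2 * omega2DT f (1 / Real.sqrt m) := by
  have hW := omega2DT_nonneg f (1 / Real.sqrt m)
  have a := sub_two_mul_le_sum_bern hf hm hW hx fun u d hd h0 h1 hmd =>
    (abs_le.1 (abs_second_difference_le_omega2DT hf hm hd h0 h1 hmd)).1
  have b := sub_two_mul_le_sum_bern (f := fun t => -f t) hf.neg hm hW hx fun u d hd h0 h1 hmd => by
    linarith [(abs_le.1 (abs_second_difference_le_omega2DT hf hm hd h0 h1 hmd)).2]
  simp only [mul_neg, Finset.sum_neg_distrib] at b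
  rw [abs_le]
  constructor <;> linarith

lemma abs_sub_le_nat_mul_omega1 {f : ℝ → ℝ} (hf : ContinuousOn f (Set.Icc 0 1)) {δ : ℝ} (k : ℕ)
    {x y : ℝ} (hx : x ∈ Set.Icc (0 : ℝ) 1) (hy : y ∈ Set.Icc (0 : ℝ) 1) (hxy : |x - y| ≤ k * δ) :
    |f x - f y| ≤ k * omega1 f δ := by
  induction k generalizing x with
  | zero =>
    have : x = y := by
      rw [Nat.cast_zero, zero_mul] at hxy
      exact sub_eq_zero.1 (abs_nonpos_iff.1 hxy)
    simp [this]
  | succ k ih =>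
    have hk : (0 : ℝ) < k + 1 := by positivity
    rw [Nat.cast_succ] at hxy ⊢
    set r : ℝ := 1 / (k + 1) with hr
    have hr0 : 0 ≤ r := by positivity
    have hr1 : r ≤ 1 := by
      rw [hr, div_le_one hk]
      linarith [(Nat.cast_nonneg k : (0 : ℝ) ≤ k)]
    have hrk : (k + 1) * r = 1 := by rw [hr]; field_simp
    have hz : x + r * (y - x) ∈ Set.Icc (0 : ℝ) 1 :=
      (convex_Icc (0 : ℝ) 1).add_smul_sub_mem hx hy ⟨hr0, hr1⟩
    have e1 : |x - (x + r * (y - x))| ≤ δ := by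
      have : x - (x + r * (y - x)) = r * (x - y) := by ring
      rw [this, abs_mul, abs_of_nonneg hr0]
      calc r * |x - y| ≤ r * ((k + 1) * δ) := mul_le_mul_of_nonneg_left hxy hr0
        _ = (k + 1) * r * δ := by ring
        _ = δ := by rw [hrk, one_mul]
    have e2 : |x + r * (y - x) - y| ≤ k * δ := by
      have : x + r * (y - x) - y = (1 - r) * (x - y) := by ring
      rw [this, abs_mul, abs_of_nonneg (sub_nonneg.2 hr1)]
      calc (1 - r) * |x - y| ≤ (1 - r) * ((k + 1) * δ) :=
            mul_le_mul_of_nonneg_left hxy (sub_nonneg.2 hr1)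
        _ = (k + 1 - (k + 1) * r) * δ := by ring
        _ = k * δ := by rw [hrk]; ring
    calc |f x - f y| ≤ |f x - f (x + r * (y - x))| + |f (x + r * (y - x)) - f y| :=
          abs_sub_le _ _ _
      _ ≤ omega1 f δ + k * omega1 f δ := add_le_add (abs_sub_le_omega1 hf hx hz e1) (ih hz e2)
      _ = (k + 1) * omega1 f δ := by ring

lemma abs_integral_sub_le_of_forall_mem {α : Type*} [MeasurableSpace α] {μ : Measure α}
    [IsProbabilityMeasure μ] {s : Set α} (hs : ∀ᵐ t ∂μ, t ∈ s) {g : α → ℝ} (hg : Integrable g μ)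
    {b C : ℝ} (h : ∀ t ∈ s, |g t - b| ≤ C) : |∫ t, g t ∂μ - b| ≤ C := by
  have e : ∫ t, g t ∂μ - b = ∫ t, (g t - b) ∂μ := by
    rw [integral_sub hg (integrable_const b)]
    simp
  have := norm_integral_le_of_norm_le_const (f := fun t => g t - b) (hs.mono h)
  rw [e]
  simpa using this

lemma abs_Lop_sub_le {k m : ℕ} (hkm : k < m) {μ : Measure ℝ} [IsProbabilityMeasure μ]
    (hμ : μ (Set.Icc (0 : ℝ) k) = 1) {f : ℝ → ℝ} (hf : ContinuousOn f (Set.Icc 0 1)) {x : ℝ}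
    (hx : x ∈ Set.Icc (0 : ℝ) 1) :
    |Lop m k μ f x - ∑ l ∈ Finset.range (m + 1), bern m l x * f (l / m)| ≤
      k * omega1 f (1 / m) := by
  obtain ⟨n, rfl⟩ := Nat.exists_eq_add_of_le' hkm.le
  have hm : (0 : ℝ) < (n + k : ℕ) := Nat.cast_pos.2 (by lia)
  have hae : ∀ᵐ t ∂μ, t ∈ Set.Icc (0 : ℝ) k :=
    (mem_ae_iff_prob_eq_one measurableSet_Icc).2 hμ
  rw [Lop, Nat.add_sub_cancel]
  refine abs_sum_bern_sub_sum_bern_le hx n k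
    (fun l => ∫ t, f (((l : ℝ) + t) / (n + k : ℕ)) ∂μ) (fun j => f (j / (n + k : ℕ)))
    fun l hl i hi => ?_
  have hl' : (l : ℝ) ≤ n := Nat.cast_le.2 hl
  have hi' : (i : ℝ) ≤ k := Nat.cast_le.2 hi
  have hmem : ∀ t ∈ Set.Icc (0 : ℝ) k, ((l : ℝ) + t) / (n + k : ℕ) ∈ Set.Icc (0 : ℝ) 1 := by
    intro t ht
    have := ht.1
    refine ⟨by positivity, div_le_one_of_le₀ ?_ hm.le⟩
    push_cast
    linarith [ht.2]
  have hcont : ContinuousOn (fun t : ℝ => f (((l : ℝ) + t) / (n + k : ℕ))) (Set.Icc 0 k) :=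
    hf.comp (Continuous.continuousOn (by fun_prop)) hmem
  have hint : Integrable (fun t : ℝ => f (((l : ℝ) + t) / (n + k : ℕ))) μ := by
    have := hcont.integrableOn_compact (μ := μ) isCompact_Icc
    rwa [IntegrableOn, Measure.restrict_eq_self_of_ae_mem hae] at this
  refine abs_integral_sub_le_of_forall_mem hae hint fun t ht => ?_
  refine abs_sub_le_nat_mul_omega1 hf k (hmem t ht) (natCast_div_mem_Icc (by lia)) ?_
  have e : ((l : ℝ) + t) / (n + k : ℕ) - ((l + i : ℕ) : ℝ) / (n + k : ℕ) =
      (t - i) * (1 / (n + k : ℕ)) := by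
    push_cast
    ring
  rw [e, abs_mul, abs_of_nonneg (one_div_nonneg.2 hm.le)]
  refine mul_le_mul_of_nonneg_right ?_ (one_div_nonneg.2 hm.le)
  have hi0 : (0 : ℝ) ≤ i := Nat.cast_nonneg i
  rw [abs_le]
  constructor <;> linarith [ht.1, ht.2]

theorem kantorovich_uniform_bound (k m : ℕ) (hkm : k < m)
    (μ : Measure ℝ) [IsProbabilityMeasure μ] (hμ : μ (Set.Icc (0:ℝ) k) = 1)
    (f : ℝ → ℝ) (hf : ContinuousOn f (Set.Icc 0 1)) :
    (⨆ x : Set.Icc (0:ℝ) 1, |Lop m k μ f x - f x|) ≤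
      2 * k * omega1 f (1 / m) + (5 / 2) * omega2DT f (1 / Real.sqrt m) := by
  have : Nonempty (Set.Icc (0 : ℝ) 1) := ⟨⟨0, by simp⟩⟩
  refine ciSup_le fun x => ?_
  have a := abs_Lop_sub_le hkm hμ hf x.2
  have b := abs_sum_bern_sub_le hf (Nat.zero_lt_of_lt hkm) x.2
  have c : 0 ≤ k * omega1 f (1 / m) := mul_nonneg (Nat.cast_nonneg k) (omega1_nonneg f _)
  have d := omega2DT_nonneg f (1 / Real.sqrt m)
  linarith [abs_sub_le (Lop m k μ f x)
    (∑ l ∈ Finset.range (m + 1), bern m l x * f (l / m)) (f x)]
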